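/- Assume k = 2, that is, P(z) = a₂z² + a₁z + a₀ with a₂ ≠ 0, and let f = R·e^P as in the setup, with arg a₂ ∈ [0, 2π). Then for every real α with 0 < α < 1, Π_α(f) = ⋃_{i=1}^{m} { ζ ↦ e^{P(γ_i)}·A·(ζ + C)^{l_i} : A ≠ 0 with arg A = arg R̃_{γ_i}(γ_i), C ∈ ℂ } ∪ { ζ ↦ e^{A₀ + A₁ζ} : A₀ ∈ ℂ, A₁ = t·e^{iθ} for some real t > 0 and some θ with π/4 + (arg a₂)/2 ≤ θ ≤ 3π/4 + (arg a₂)/2 or 5π/4 + (arg a₂)/2 ≤ θ ≤ 7π/4 + (arg a₂)/2 }. -/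

import Mathlib

open Filter Topology Complex

noncomputable section

/-- Locally uniform convergence on `ℂ` with respect to the spherical metric,
expressed via the Euclidean criterion: near every point, either the functions
converge uniformly to `g` in the Euclidean metric, or they are eventually
nonvanishing there and their reciprocals converge uniformly to `1/g`. -/
def SphLocUnifConv (F : ℕ → ℂ → ℂ) (g : ℂ → ℂ) : Prop :=
  ∀ z₀ : ℂ, ∃ U ∈ 𝓝 z₀,
    TendstoUniformlyOn F g atTop U ∨
    ((∀ᶠ n in atTop, ∀ w ∈ U, F n w ≠ 0) ∧
      TendstoUniformlyOn (fun n w => (F n w)⁻¹) (fun w => (g w)⁻¹) atTop U)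

/-- `Π_α(h)` : the set of all nonconstant meromorphic functions `g` on `ℂ` for which
there exist `z₀ ∈ ℂ`, naturals `k n → ∞`, complex `z n → z₀` and positive reals
`ρ n → 0` such that `ζ ↦ ρ n ^ (-α) * h (k n * z n + k n * ρ n * ζ)` converges to `g`
locally uniformly on `ℂ` in the spherical metric. -/
def PiAlpha (α : ℝ) (h : ℂ → ℂ) : Set (ℂ → ℂ) :=
  { g | MeromorphicOn g Set.univ ∧ (∀ c : ℂ, g ≠ fun _ => c) ∧
      ∃ (z₀ : ℂ) (k : ℕ → ℕ) (z : ℕ → ℂ) (ρ : ℕ → ℝ),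
        Tendsto k atTop atTop ∧
        Tendsto z atTop (𝓝 z₀) ∧
        (∀ n, 0 < ρ n) ∧ Tendsto ρ atTop (𝓝 0) ∧
        SphLocUnifConv
          (fun n ζ => ((ρ n ^ (-α) : ℝ) : ℂ) * h ((k n : ℂ) * z n + (k n : ℂ) * (ρ n : ℂ) * ζ))
          g }

section SphericalConvergence

variable {F : ℕ → ℂ → ℂ} {g : ℂ → ℂ}

lemma SphLocUnifConv.comp (H : SphLocUnifConv F g) {φ : ℕ → ℕ} (hφ : StrictMono φ) :
    SphLocUnifConv (fun n => F (φ n)) g := by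
  intro z
  obtain ⟨U, hU, h | ⟨h, h'⟩⟩ := H z
  · exact ⟨U, hU, Or.inl fun u hu => hφ.tendsto_atTop.eventually (h u hu)⟩
  · exact ⟨U, hU, Or.inr ⟨hφ.tendsto_atTop.eventually h,
      fun u hu => hφ.tendsto_atTop.eventually (h' u hu)⟩⟩

lemma SphLocUnifConv.tendsto_of_ne_zero (H : SphLocUnifConv F g) {ζ : ℂ} (hζ : g ζ ≠ 0) :
    Tendsto (fun n => F n ζ) atTop (𝓝 (g ζ)) := by
  obtain ⟨U, hU, h | ⟨-, h⟩⟩ := H ζ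
  · exact h.tendsto_at (mem_of_mem_nhds hU)
  · simpa using (h.tendsto_at (mem_of_mem_nhds hU)).inv₀ (inv_ne_zero hζ)

lemma SphLocUnifConv.eq_of_tendsto (H : SphLocUnifConv F g) {ζ c : ℂ}
    (hc : Tendsto (fun n => F n ζ) atTop (𝓝 c)) : g ζ = c := by
  by_cases hζ : g ζ = 0
  · obtain ⟨U, hU, h | ⟨h, h'⟩⟩ := H ζ
    · exact tendsto_nhds_unique (h.tendsto_at (mem_of_mem_nhds hU)) hc
    · have h1 := (h'.tendsto_at (mem_of_mem_nhds hU)).mul hc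
      have h2 : Tendsto (fun n => (F n ζ)⁻¹ * F n ζ) atTop (𝓝 1) := by
        refine tendsto_const_nhds.congr' ?_
        filter_upwards [h] with n hn
        rw [inv_mul_cancel₀ (hn ζ (mem_of_mem_nhds hU))]
      have := tendsto_nhds_unique h1 h2
      simp [hζ] at this
  · exact tendsto_nhds_unique (H.tendsto_of_ne_zero hζ) hc

lemma SphLocUnifConv.eq_zero_of_tendsto_norm_atTop (H : SphLocUnifConv F g) {ζ : ℂ}
    (hc : Tendsto (fun n => ‖F n ζ‖) atTop atTop) : g ζ = 0 := by
  by_contra hζ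
  exact not_tendsto_nhds_of_tendsto_atTop hc _ (H.tendsto_of_ne_zero hζ).norm

lemma eq_zero_of_tendstoUniformlyOn_of_eventually_eq_zero {ζ : ℂ} {U : Set ℂ} (hU : U ∈ 𝓝 ζ)
    (h : TendstoUniformlyOn F g atTop U) (hF : ∀ᶠ n in atTop, ContinuousAt (F n) ζ)
    (hg : ∀ᶠ w in 𝓝[≠] ζ, g w = 0) : g ζ = 0 := by
  by_contra hne
  have hcont : ContinuousAt g ζ := by
    refine continuousAt_of_locally_uniform_approx_of_continuousAt fun u hu => ?_
    obtain ⟨n, hn, hn'⟩ := ((h u hu).and hF).exists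
    exact ⟨U, hU, F n, hn', hn⟩
  exact hne (tendsto_nhds_unique (hcont.mono_left nhdsWithin_le_nhds)
    (tendsto_const_nhds.congr' (hg.mono fun w hw => hw.symm)))

/-- A meromorphic spherical limit that vanishes on a nonempty open set vanishes identically. -/
lemma SphLocUnifConv.eq_zero_of_eqOn_open (H : SphLocUnifConv F g)
    (hF : ∀ n ζ, F n ζ ≠ 0 → ContinuousAt (F n) ζ) (hg : MeromorphicOn g Set.univ)
    {U : Set ℂ} (hU : IsOpen U) (hne : U.Nonempty) (h0 : ∀ ζ ∈ U, g ζ = 0) (ζ : ℂ) :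
    g ζ = 0 := by
  obtain ⟨u, hu⟩ := hne
  have hloc : ∀ᶠ w in 𝓝[≠] ζ, g w = 0 := by
    rw [← meromorphicOrderAt_eq_top_iff]
    by_contra hζ
    refine hg.meromorphicOrderAt_ne_top_of_isPreconnected isPreconnected_univ
      (Set.mem_univ ζ) (Set.mem_univ u) hζ (meromorphicOrderAt_eq_top_iff.2 ?_)
    exact (eventually_of_mem (hU.mem_nhds hu) h0).filter_mono nhdsWithin_le_nhds
  by_contra hne
  have hev : ∀ᶠ n in atTop, F n ζ ≠ 0 := (H.tendsto_of_ne_zero hne).eventually_ne hne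
  obtain ⟨V, hV, h | ⟨-, h⟩⟩ := H ζ
  · exact hne (eq_zero_of_tendstoUniformlyOn_of_eventually_eq_zero hV h
      (hev.mono fun n hn => hF n ζ hn) hloc)
  · refine inv_ne_zero hne (eq_zero_of_tendstoUniformlyOn_of_eventually_eq_zero
      (g := fun w => (g w)⁻¹) hV h (hev.mono fun n hn => (hF n ζ hn).inv₀ hn) (hloc.mono fun w hw => ?_))
    simp [hw]

/-- Continuous convergence implies spherical locally uniform convergence. -/
lemma sphLocUnifConv_of_tendsto_prod (hg : Continuous g)
    (h : ∀ ζ, Tendsto (fun q : ℕ × ℂ => F q.1 q.2) (atTop ×ˢ 𝓝 ζ) (𝓝 (g ζ))) :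
    SphLocUnifConv F g := by
  have hl : TendstoLocallyUniformly F g atTop := by
    rw [tendstoLocallyUniformly_iff_forall_tendsto]
    intro ζ
    have h1 : Tendsto (fun q : ℕ × ℂ => g q.2) (atTop ×ˢ 𝓝 ζ) (𝓝 (g ζ)) :=
      hg.continuousAt.tendsto.comp tendsto_snd
    exact (h1.prodMk_nhds (h ζ)).mono_right (nhds_le_uniformity (g ζ))
  intro z
  refine ⟨Metric.closedBall z 1, Metric.closedBall_mem_nhds z one_pos, Or.inl ?_⟩
  exact (tendstoLocallyUniformlyOn_iff_tendstoUniformlyOn_of_compact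
    (isCompact_closedBall z 1)).1 hl.tendstoLocallyUniformlyOn

end SphericalConvergence

/-- A sequence in `ℂ` tends to infinity or has a convergent subsequence. -/
lemma tendsto_norm_atTop_or_exists_subseq (u : ℕ → ℂ) :
    Tendsto (fun n => ‖u n‖) atTop atTop ∨
      ∃ (a : ℂ) (φ : ℕ → ℕ), StrictMono φ ∧ Tendsto (u ∘ φ) atTop (𝓝 a) := by
  by_cases h : Tendsto (fun n => ‖u n‖) atTop atTop
  · exact Or.inl h
  · right
    rw [tendsto_atTop] at h
    push Not at h
    obtain ⟨b, hb⟩ := h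
    obtain ⟨a, -, φ, hφ, ha⟩ := tendsto_subseq_of_frequently_bounded
      (Metric.isBounded_closedBall (x := (0 : ℂ)) (r := b))
      (x := u) (hb.mono fun n hn => by simpa using hn.le)
    exact ⟨a, φ, hφ, ha⟩

/-- The monic polynomial function with roots `γ i` of multiplicity `l i`. -/
def rootProd {m : ℕ} (γ : Fin m → ℂ) (l : Fin m → ℕ) (z : ℂ) : ℂ := ∏ i, (z - γ i) ^ l i

/-- A rational function times the exponential of a quadratic polynomial. -/
def expRat {m p : ℕ} (γ : Fin m → ℂ) (lm : Fin m → ℕ) (β : Fin p → ℂ) (jp : Fin p → ℕ)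
    (a₂ a₁ a₀ : ℂ) (z : ℂ) : ℂ :=
  rootProd γ lm z / rootProd β jp z * exp (a₂ * z ^ 2 + a₁ * z + a₀)

section ExpRat

variable {m p : ℕ} {γ : Fin m → ℂ} {lm : Fin m → ℕ} {β : Fin p → ℂ} {jp : Fin p → ℕ}
  {a₂ a₁ a₀ : ℂ} {ι : Type*} {l : Filter ι}

lemma continuous_rootProd (γ : Fin m → ℂ) (lm : Fin m → ℕ) : Continuous (rootProd γ lm) := by
  unfold rootProd
  fun_prop

lemma rootProd_ne_zero {z : ℂ} (h : ∀ i, z ≠ γ i) : rootProd γ lm z ≠ 0 :=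
  Finset.prod_ne_zero_iff.2 fun i _ => pow_ne_zero _ (sub_ne_zero.2 (h i))

lemma continuousAt_expRat {z : ℂ} (hz : rootProd β jp z ≠ 0) :
    ContinuousAt (expRat γ lm β jp a₂ a₁ a₀) z := by
  unfold expRat
  exact ((continuous_rootProd γ lm).continuousAt.div (continuous_rootProd β jp).continuousAt hz).mul
    (by fun_prop)

lemma continuousAt_expRat_of_ne_zero {z : ℂ} (hz : expRat γ lm β jp a₂ a₁ a₀ z ≠ 0) :
    ContinuousAt (expRat γ lm β jp a₂ a₁ a₀) z := by
  refine continuousAt_expRat fun h => hz ?_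
  simp [expRat, h]

lemma continuousAt_inv_expRat {z : ℂ} (hz : rootProd γ lm z ≠ 0) :
    ContinuousAt (fun z => (expRat γ lm β jp a₂ a₁ a₀ z)⁻¹) z := by
  simp only [expRat, mul_inv, inv_div, ← exp_neg]
  exact ((continuous_rootProd β jp).continuousAt.div (continuous_rootProd γ lm).continuousAt hz).mul
    (by fun_prop)

lemma tendsto_inv_of_norm_atTop {s : ι → ℂ} (hs : Tendsto (fun i => ‖s i‖) l atTop) :
    Tendsto (fun i => (s i)⁻¹) l (𝓝 0) := by
  rw [tendsto_zero_iff_norm_tendsto_zero]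
  simp only [norm_inv]
  exact hs.inv_tendsto_atTop

lemma tendsto_norm_ofReal_atTop {s : ι → ℝ} (hs : Tendsto s l atTop) :
    Tendsto (fun i => ‖(s i : ℂ)‖) l atTop := by
  simp only [norm_real]
  exact tendsto_norm_atTop_atTop.comp hs

lemma tendsto_rootProd_div_pow (γ : Fin m → ℂ) (lm : Fin m → ℕ) {x s : ι → ℂ} {L : ℂ}
    (hx : Tendsto (fun i => x i / s i) l (𝓝 L)) (hs : Tendsto (fun i => ‖s i‖) l atTop) :
    Tendsto (fun i => rootProd γ lm (x i) / s i ^ (∑ j, lm j)) l (𝓝 (L ^ (∑ j, lm j))) := by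
  simp only [rootProd, ← Finset.prod_pow_eq_pow_sum, ← Finset.prod_div_distrib, ← div_pow]
  refine tendsto_finsetProd _ fun j _ => Tendsto.pow ?_ _
  simpa [sub_mul, div_eq_mul_inv] using hx.sub ((tendsto_inv_of_norm_atTop hs).const_mul (γ j))

lemma tendsto_ratio_div_pow (γ : Fin m → ℂ) (lm : Fin m → ℕ) (β : Fin p → ℂ) (jp : Fin p → ℕ)
    {x s : ι → ℂ} {L : ℂ} (hL : L ≠ 0)
    (hx : Tendsto (fun i => x i / s i) l (𝓝 L)) (hs : Tendsto (fun i => ‖s i‖) l atTop) :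
    Tendsto (fun i => rootProd γ lm (x i) / rootProd β jp (x i) /
      (s i ^ (∑ j, lm j) / s i ^ (∑ j, jp j))) l (𝓝 (L ^ (∑ j, lm j) / L ^ (∑ j, jp j))) := by
  exact ((tendsto_rootProd_div_pow γ lm hx hs).div (tendsto_rootProd_div_pow β jp hx hs)
    (pow_ne_zero _ hL)).congr fun i => div_div_div_comm _ _ _ _

lemma tendsto_ratio_div_ratio (γ : Fin m → ℂ) (lm : Fin m → ℕ) (β : Fin p → ℂ) (jp : Fin p → ℕ)
    {x y : ι → ℂ} (hx : Tendsto (fun i => ‖x i‖) l atTop)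
    (hy : Tendsto (fun i => y i / x i) l (𝓝 1)) :
    Tendsto (fun i => (rootProd γ lm (y i) / rootProd β jp (y i)) /
      (rootProd γ lm (x i) / rootProd β jp (x i))) l (𝓝 1) := by
  have hne : ∀ᶠ i in l, x i ≠ 0 :=
    (hx.eventually_gt_atTop 0).mono fun i hi => norm_pos_iff.1 hi
  have hxx : Tendsto (fun i => x i / x i) l (𝓝 1) :=
    tendsto_const_nhds.congr' (hne.mono fun i hi => (div_self hi).symm)
  have h := (tendsto_ratio_div_pow γ lm β jp one_ne_zero hy hx).div
    (tendsto_ratio_div_pow γ lm β jp one_ne_zero hxx hx) (by simp)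
  simp only [one_pow, div_one] at h
  refine h.congr' (hne.mono fun i hi => ?_)
  exact div_div_div_cancel_right₀ (div_ne_zero (pow_ne_zero _ hi) (pow_ne_zero _ hi)) _ _

lemma expRat_div_expRat (x s : ℂ) :
    expRat γ lm β jp a₂ a₁ a₀ (x + s) / expRat γ lm β jp a₂ a₁ a₀ x =
      (rootProd γ lm (x + s) / rootProd β jp (x + s)) / (rootProd γ lm x / rootProd β jp x) *
        exp (s * (2 * a₂ * x + a₁) + a₂ * s ^ 2) := by
  have : s * (2 * a₂ * x + a₁) + a₂ * s ^ 2 =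
    (a₂ * (x + s) ^ 2 + a₁ * (x + s) + a₀) - (a₂ * x ^ 2 + a₁ * x + a₀) := by ring
  rw [this, exp_sub, expRat, expRat, mul_div_mul_comm]

lemma tendsto_norm_linear_atTop (ha : a₂ ≠ 0) {x : ι → ℂ}
    (hx : Tendsto (fun i => ‖x i‖) l atTop) :
    Tendsto (fun i => ‖2 * a₂ * x i + a₁‖) l atTop := by
  have h1 : Tendsto (fun i => ‖2 * a₂‖ * ‖x i‖ + (-‖a₁‖)) l atTop :=
    tendsto_atTop_add_const_right _ _ (hx.const_mul_atTop (norm_pos_iff.2 (by simpa using ha)))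
  refine tendsto_atTop_mono (fun i => ?_) h1
  rw [← norm_mul]
  simpa [sub_eq_add_neg] using norm_sub_le_norm_add (2 * a₂ * x i) a₁

lemma tendsto_zero_of_tendsto_mul_linear (ha : a₂ ≠ 0) {x σ : ι → ℂ} {b : ℂ}
    (hx : Tendsto (fun i => ‖x i‖) l atTop)
    (hb : Tendsto (fun i => σ i * (2 * a₂ * x i + a₁)) l (𝓝 b)) : Tendsto σ l (𝓝 0) := by
  have hlin := tendsto_norm_linear_atTop (a₁ := a₁) ha hx
  have := hb.mul (tendsto_inv_of_norm_atTop hlin)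
  rw [mul_zero] at this
  refine this.congr' ((hlin.eventually_gt_atTop 0).mono fun i hi => ?_)
  exact mul_inv_cancel_right₀ (norm_pos_iff.1 hi) _

lemma tendsto_expRat_div (ha : a₂ ≠ 0) {x σ η : ι → ℂ} {b η₀ : ℂ}
    (hx : Tendsto (fun i => ‖x i‖) l atTop)
    (hb : Tendsto (fun i => σ i * (2 * a₂ * x i + a₁)) l (𝓝 b)) (hη : Tendsto η l (𝓝 η₀)) :
    Tendsto (fun i => expRat γ lm β jp a₂ a₁ a₀ (x i + σ i * η i) /
      expRat γ lm β jp a₂ a₁ a₀ (x i)) l (𝓝 (exp (b * η₀))) := by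
  have hσ := tendsto_zero_of_tendsto_mul_linear ha hx hb
  have hy : Tendsto (fun i => (x i + σ i * η i) / x i) l (𝓝 1) := by
    have h := ((hσ.mul hη).mul (tendsto_inv_of_norm_atTop hx)).const_add 1
    simp only [zero_mul, add_zero] at h
    refine h.congr' ((hx.eventually_gt_atTop 0).mono fun i hi => ?_)
    have := norm_pos_iff.1 hi
    field_simp
  have hexp : Tendsto (fun i => σ i * η i * (2 * a₂ * x i + a₁) + a₂ * (σ i * η i) ^ 2) l
      (𝓝 (b * η₀)) := by
    have h := (hb.mul hη).add (((hσ.mul hη).pow 2).const_mul a₂)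
    simp only [zero_mul, ne_eq, OfNat.ofNat_ne_zero, not_false_eq_true, zero_pow, mul_zero,
      add_zero] at h
    exact h.congr fun i => by ring
  simp only [expRat_div_expRat]
  simpa using (tendsto_ratio_div_ratio γ lm β jp hx hy).mul
    ((continuous_exp.tendsto _).comp hexp)

end ExpRat

/-- The properties of a limit `g` of the rescaled functions `η ↦ c n * f (x n + σ n * η)` that are
needed to identify `g`: pointwise limits along subsequences agree with `g`, and no subsequence
tends to infinity on a nonempty open set. -/
structure RescaledLimit (f : ℂ → ℂ) (c : ℕ → ℝ) (x : ℕ → ℂ) (σ : ℕ → ℝ) (g : ℂ → ℂ) : Prop where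
  c_atTop : Tendsto c atTop atTop
  σ_pos : ∀ n, 0 < σ n
  g_zero_ne : g 0 ≠ 0
  tendsto_zero : Tendsto (fun n => (c n : ℂ) * f (x n)) atTop (𝓝 (g 0))
  eq_lim : ∀ φ : ℕ → ℕ, StrictMono φ → ∀ η d : ℂ,
    Tendsto (fun n => (c (φ n) : ℂ) * f (x (φ n) + σ (φ n) * η)) atTop (𝓝 d) → g η = d
  not_atTop : ∀ φ : ℕ → ℕ, StrictMono φ → ∀ U : Set ℂ, IsOpen U → U.Nonempty →
    ¬ ∀ η ∈ U, Tendsto (fun n => ‖(c (φ n) : ℂ) * f (x (φ n) + σ (φ n) * η)‖) atTop atTop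
  nonconst : ¬ ∀ η, g η = g 0

namespace RescaledLimit

variable {f g : ℂ → ℂ} {c σ : ℕ → ℝ} {x : ℕ → ℂ}

lemma comp (h : RescaledLimit f c x σ g) {ψ : ℕ → ℕ} (hψ : StrictMono ψ) :
    RescaledLimit f (c ∘ ψ) (x ∘ ψ) (σ ∘ ψ) g where
  c_atTop := h.c_atTop.comp hψ.tendsto_atTop
  σ_pos _ := h.σ_pos _
  g_zero_ne := h.g_zero_ne
  tendsto_zero := h.tendsto_zero.comp hψ.tendsto_atTop
  eq_lim φ hφ := h.eq_lim (ψ ∘ φ) (hψ.comp hφ)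
  not_atTop φ hφ := h.not_atTop (ψ ∘ φ) (hψ.comp hφ)
  nonconst := h.nonconst

lemma tendsto_f (h : RescaledLimit f c x σ g) : Tendsto (fun n => f (x n)) atTop (𝓝 0) := by
  have hc : Tendsto (fun n => ((c n : ℂ))⁻¹) atTop (𝓝 0) :=
    tendsto_inv_of_norm_atTop (tendsto_norm_ofReal_atTop h.c_atTop)
  have := hc.mul h.tendsto_zero
  rw [zero_mul] at this
  refine this.congr' ((h.c_atTop.eventually_gt_atTop 0).mono fun n hn => ?_)
  exact inv_mul_cancel_left₀ (ofReal_ne_zero.2 hn.ne') _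

lemma eventually_f_ne_zero (h : RescaledLimit f c x σ g) : ∀ᶠ n in atTop, f (x n) ≠ 0 :=
  (h.tendsto_zero.eventually_ne h.g_zero_ne).mono fun _ hn => right_ne_zero_of_mul hn

end RescaledLimit

section Cases

variable {m p : ℕ} {γ : Fin m → ℂ} {lm : Fin m → ℕ} {β : Fin p → ℂ} {jp : Fin p → ℕ}
  {a₂ a₁ a₀ : ℂ} {g : ℂ → ℂ} {c σ : ℕ → ℝ} {x : ℕ → ℂ}

lemma norm_expRat (z : ℂ) : ‖expRat γ lm β jp a₂ a₁ a₀ z‖ =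
    ‖rootProd γ lm z / rootProd β jp z‖ * Real.exp (a₂ * z ^ 2 + a₁ * z + a₀).re := by
  rw [expRat, norm_mul, norm_exp]

lemma RescaledLimit.false_of_scale_atTop (ha : a₂ ≠ 0)
    (h : RescaledLimit (expRat γ lm β jp a₂ a₁ a₀) c x σ g) (hσ : Tendsto σ atTop atTop)
    {q : ℂ} (hq : Tendsto (fun n => x n / σ n) atTop (𝓝 q)) : False := by
  refine h.not_atTop id strictMono_id {η | 0 < (a₂ * (η + q) ^ 2).re}
    (isOpen_lt continuous_const (by fun_prop)) ?_ ?_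
  · obtain ⟨w, hw⟩ := IsAlgClosed.exists_pow_nat_eq (a₂⁻¹) two_pos
    refine ⟨w - q, ?_⟩
    rw [Set.mem_ofPred_eq, sub_add_cancel, hw, mul_inv_cancel₀ ha]
    exact one_pos
  intro η hη
  have hL : η + q ≠ 0 := by
    rintro h0
    simp [h0] at hη
  simp only [Set.mem_ofPred_eq] at hη
  simp only [id]
  set L := η + q
  set y : ℕ → ℂ := fun n => x n + σ n * η with hy
  have hσC : Tendsto (fun n => ‖(σ n : ℂ)‖) atTop atTop :=
    tendsto_norm_ofReal_atTop hσ
  have hyL : Tendsto (fun n => y n / σ n) atTop (𝓝 L) := by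
    have := hq.const_add η
    refine this.congr fun n => ?_
    have : (σ n : ℂ) ≠ 0 := ofReal_ne_zero.2 (h.σ_pos n).ne'
    simp only [hy]
    field_simp
    ring
  have hQ := (tendsto_ratio_div_pow γ lm β jp hL hyL hσC).norm
  have hP : Tendsto (fun n => ((a₂ * y n ^ 2 + a₁ * y n + a₀) * ((σ n ^ 2)⁻¹ : ℝ)).re) atTop
      (𝓝 (a₂ * L ^ 2).re) := by
    refine (continuous_re.tendsto _).comp ?_
    have hi := tendsto_inv_of_norm_atTop hσC
    have h1 := (((hyL.pow 2).const_mul a₂).add ((hyL.mul hi).const_mul a₁)).add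
      ((hi.pow 2).const_mul a₀)
    simp only [mul_zero, add_zero, ne_eq, OfNat.ofNat_ne_zero, not_false_eq_true, zero_pow] at h1
    refine h1.congr fun n => ?_
    push_cast
    simp only [div_eq_mul_inv]
    ring
  have hmain : Tendsto (fun n => ‖rootProd γ lm (y n) / rootProd β jp (y n) /
      ((σ n : ℂ) ^ (∑ j, lm j) / (σ n : ℂ) ^ (∑ j, jp j))‖ *
        (Real.exp (σ n) / σ n ^ (∑ j, jp j))) atTop atTop :=
    hQ.pos_mul_atTop (norm_pos_iff.2 (div_ne_zero (pow_ne_zero _ hL) (pow_ne_zero _ hL)))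
      ((Real.tendsto_exp_div_pow_atTop _).comp hσ)
  refine tendsto_atTop_mono' _ ?_ hmain
  filter_upwards [h.c_atTop.eventually_ge_atTop 1, hσ.eventually_ge_atTop 1,
    hP.eventually_const_lt (half_lt_self hη),
    hσ.eventually_ge_atTop (2 / (a₂ * L ^ 2).re)] with n hc hσ1 hPn hσ2
  have hσ0 := h.σ_pos n
  rw [re_mul_ofReal] at hPn
  have hre : σ n ≤ (a₂ * y n ^ 2 + a₁ * y n + a₀).re := by
    rw [div_le_iff₀ hη] at hσ2
    rw [← div_eq_mul_inv, lt_div_iff₀ (by positivity)] at hPn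
    nlinarith
  rw [norm_mul, norm_expRat, norm_div (_ / _) (_ / _), norm_div ((σ n : ℂ) ^ _), norm_pow, norm_pow,
    norm_real, Real.norm_of_nonneg hσ0.le, norm_real, Real.norm_of_nonneg (by linarith)]
  set A := ‖rootProd γ lm (y n) / rootProd β jp (y n)‖
  calc A / (σ n ^ (∑ j, lm j) / σ n ^ (∑ j, jp j)) * (Real.exp (σ n) / σ n ^ (∑ j, jp j))
      = A * Real.exp (σ n) / σ n ^ (∑ j, lm j) := by field_simp
    _ ≤ A * Real.exp (σ n) := div_le_self (by positivity) (one_le_pow₀ hσ1)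
    _ ≤ A * Real.exp (a₂ * y n ^ 2 + a₁ * y n + a₀).re := by gcongr
    _ ≤ c n * (A * Real.exp (a₂ * y n ^ 2 + a₁ * y n + a₀).re) :=
        le_mul_of_one_le_left (by positivity) hc

lemma RescaledLimit.false_of_scale_tendsto_pos
    (h : RescaledLimit (expRat γ lm β jp a₂ a₁ a₀) c x σ g) {s : ℝ} (hs : 0 < s)
    (hσ : Tendsto σ atTop (𝓝 s)) {x₀ : ℂ} (hx : Tendsto x atTop (𝓝 x₀)) : False := by
  have hs' : (s : ℂ) ≠ 0 := ofReal_ne_zero.2 hs.ne'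
  refine h.not_atTop id strictMono_id
    {η | rootProd γ lm (x₀ + s * η) ≠ 0 ∧ rootProd β jp (x₀ + s * η) ≠ 0}
    ((isOpen_ne_fun ((continuous_rootProd γ lm).comp (by fun_prop)) continuous_const).inter
      (isOpen_ne_fun ((continuous_rootProd β jp).comp (by fun_prop)) continuous_const)) ?_ ?_
  · obtain ⟨y, hy⟩ := ((Set.finite_range γ).union (Set.finite_range β)).infinite_compl.nonempty
    simp only [Set.mem_compl_iff, Set.mem_union, Set.mem_range, not_or, not_exists] at hy
    refine ⟨(y - x₀) / s, ?_⟩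
    simp only [Set.mem_ofPred_eq, mul_div_cancel₀ _ hs', add_sub_cancel]
    exact ⟨rootProd_ne_zero fun i => Ne.symm (hy.1 i), rootProd_ne_zero fun i => Ne.symm (hy.2 i)⟩
  rintro η ⟨h1, h2⟩
  have hy : Tendsto (fun n => x n + σ n * η) atTop (𝓝 (x₀ + s * η)) :=
    hx.add (((continuous_ofReal.tendsto _).comp hσ).mul_const η)
  have hf := ((continuousAt_expRat (γ := γ) (lm := lm) (a₂ := a₂) (a₁ := a₁) (a₀ := a₀)
    h2).tendsto.comp hy).norm
  simp only [id, norm_mul]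
  refine Tendsto.atTop_mul_pos (norm_pos_iff.2 ?_) ?_ hf
  · exact mul_ne_zero (div_ne_zero h1 h2) (exp_ne_zero _)
  · exact tendsto_norm_ofReal_atTop h.c_atTop

lemma exists_eq_root_of_tendsto_expRat {x₀ : ℂ} (hx : Tendsto x atTop (𝓝 x₀))
    (hne : ∀ᶠ n in atTop, expRat γ lm β jp a₂ a₁ a₀ (x n) ≠ 0)
    (h0 : Tendsto (fun n => expRat γ lm β jp a₂ a₁ a₀ (x n)) atTop (𝓝 0)) : ∃ i, x₀ = γ i := by
  by_contra! hcon
  have h1 := ((continuousAt_inv_expRat (β := β) (jp := jp) (a₂ := a₂) (a₁ := a₁) (a₀ := a₀)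
    (rootProd_ne_zero (lm := lm) hcon)).tendsto.comp hx).mul h0
  rw [mul_zero] at h1
  have h2 : Tendsto (fun _ : ℕ => (1 : ℂ)) atTop (𝓝 0) :=
    h1.congr' (hne.mono fun n hn => inv_mul_cancel₀ hn)
  exact one_ne_zero (tendsto_nhds_unique tendsto_const_nhds h2)

/-- The quotient of `expRat` by its factor `(z - γ i) ^ lm i`. -/
def expRatCofactor {m p : ℕ} (γ : Fin m → ℂ) (lm : Fin m → ℕ) (β : Fin p → ℂ) (jp : Fin p → ℕ)
    (a₂ a₁ a₀ : ℂ) (i : Fin m) (z : ℂ) : ℂ :=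
  (∏ j ∈ Finset.univ.erase i, (z - γ j) ^ lm j) / (∏ j, (z - β j) ^ jp j) *
    exp (a₂ * z ^ 2 + a₁ * z + a₀)

lemma expRat_eq_mul_cofactor (i : Fin m) (z : ℂ) : expRat γ lm β jp a₂ a₁ a₀ z =
    (z - γ i) ^ lm i * expRatCofactor γ lm β jp a₂ a₁ a₀ i z := by
  rw [expRat, expRatCofactor, rootProd, rootProd,
    ← Finset.mul_prod_erase Finset.univ _ (Finset.mem_univ i)]
  ring

lemma prod_sub_ne_zero (hγβ : ∀ i j, γ i ≠ β j) (i : Fin m) :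
    ∏ j, (γ i - β j) ^ jp j ≠ 0 :=
  Finset.prod_ne_zero_iff.2 fun j _ => pow_ne_zero _ (sub_ne_zero.2 (hγβ i j))

lemma continuousAt_expRatCofactor (hγβ : ∀ i j, γ i ≠ β j) (i : Fin m) :
    ContinuousAt (expRatCofactor γ lm β jp a₂ a₁ a₀ i) (γ i) := by
  unfold expRatCofactor
  refine ContinuousAt.mul (ContinuousAt.div ?_ ?_ (prod_sub_ne_zero hγβ i)) ?_ <;> fun_prop

lemma expRatCofactor_ne_zero (hγ : Function.Injective γ) (hγβ : ∀ i j, γ i ≠ β j) (i : Fin m) :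
    expRatCofactor γ lm β jp a₂ a₁ a₀ i (γ i) ≠ 0 := by
  refine mul_ne_zero (div_ne_zero (Finset.prod_ne_zero_iff.2 fun j hj => pow_ne_zero _ ?_)
    (prod_sub_ne_zero hγβ i)) (exp_ne_zero _)
  exact sub_ne_zero.2 (hγ.ne (Finset.ne_of_mem_erase hj).symm)

lemma RescaledLimit.eq_pow (hγ : Function.Injective γ) (hγβ : ∀ i j, γ i ≠ β j)
    (hlm : ∀ i, 1 ≤ lm i) (h : RescaledLimit (expRat γ lm β jp a₂ a₁ a₀) c x σ g)
    (hσ : Tendsto σ atTop (𝓝 0)) {x₀ : ℂ} (hx : Tendsto x atTop (𝓝 x₀)) :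
    ∃ (i : Fin m) (t : ℝ) (C : ℂ), 0 < t ∧ ∀ η, g η =
      expRatCofactor γ lm β jp a₂ a₁ a₀ i (γ i) * t * (η + C) ^ lm i := by
  obtain ⟨i, rfl⟩ := exists_eq_root_of_tendsto_expRat hx h.eventually_f_ne_zero h.tendsto_f
  set G := expRatCofactor γ lm β jp a₂ a₁ a₀ i with hG
  have hG0 : G (γ i) ≠ 0 := expRatCofactor_ne_zero hγ hγβ i
  have hGc : ContinuousAt G (γ i) := continuousAt_expRatCofactor hγβ i
  have hσC : Tendsto (fun n => (σ n : ℂ)) atTop (𝓝 0) := by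
    rw [← ofReal_zero]
    exact (continuous_ofReal.tendsto _).comp hσ
  have hGy : ∀ η, Tendsto (fun n => G (x n + σ n * η)) atTop (𝓝 (G (γ i))) := fun η =>
    hGc.tendsto.comp (by simpa using hx.add (hσC.mul_const η))
  have hGx : Tendsto (fun n => G (x n)) atTop (𝓝 (G (γ i))) := hGc.tendsto.comp hx
  have hne : ∀ᶠ n in atTop, x n - γ i ≠ 0 ∧ G (x n) ≠ 0 := by
    filter_upwards [h.eventually_f_ne_zero, hGx.eventually_ne hG0] with n hn hn'
    refine ⟨fun h0 => hn ?_, hn'⟩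
    rw [expRat_eq_mul_cofactor i, h0, zero_pow (by have := hlm i; omega), zero_mul]
  have key : ∀ η, (fun n => (c n * expRat γ lm β jp a₂ a₁ a₀ (x n)) *
      (1 + σ n / (x n - γ i) * η) ^ lm i * (G (x n + σ n * η) / G (x n))) =ᶠ[atTop]
      fun n => (c n : ℂ) * expRat γ lm β jp a₂ a₁ a₀ (x n + σ n * η) := by
    intro η
    filter_upwards [hne] with n ⟨h1, h2⟩
    rw [expRat_eq_mul_cofactor i, expRat_eq_mul_cofactor i, ← hG]
    have : x n + σ n * η - γ i = (x n - γ i) * (1 + σ n / (x n - γ i) * η) := by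
      field_simp
      ring
    rw [this, mul_pow]
    field_simp
  have hratio : ∀ η, Tendsto (fun n => G (x n + σ n * η) / G (x n)) atTop (𝓝 1) := fun η => by
    rw [← div_self hG0]
    exact (hGy η).div hGx hG0
  rcases tendsto_norm_atTop_or_exists_subseq (fun n => σ n / (x n - γ i)) with hr | ⟨r, φ, hφ, hr⟩
  · refine (h.not_atTop id strictMono_id {η | η ≠ 0} isOpen_ne ⟨1, one_ne_zero⟩ ?_).elim
    intro η hη
    simp only [id]
    refine Tendsto.congr' ((key η).fun_comp norm) ?_
    have h1 : Tendsto (fun n => ‖1 + σ n / (x n - γ i) * η‖) atTop atTop := by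
      refine (tendsto_norm_linear_atTop (a₂ := η / 2) (a₁ := 1) (div_ne_zero hη two_ne_zero)
        hr).congr fun n => ?_
      rw [mul_div_cancel₀ _ two_ne_zero, add_comm, mul_comm η]
    have h2 := (h.tendsto_zero.norm.pos_mul_atTop (norm_pos_iff.2 h.g_zero_ne)
      ((tendsto_pow_atTop (by have := hlm i; omega : lm i ≠ 0)).comp h1)).atTop_mul_pos
      (by simp) (hratio η).norm
    refine h2.congr fun n => ?_
    simp only [Function.comp_apply, norm_mul, norm_pow]
  · have hlim : ∀ η, g η = g 0 * (1 + r * η) ^ lm i := by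
      intro η
      refine h.eq_lim φ hφ η _ ?_
      refine Tendsto.congr' (hφ.tendsto_atTop.eventually (key η)) ?_
      simpa using ((h.tendsto_zero.comp hφ.tendsto_atTop).mul
        (((hr.mul_const η).const_add 1).pow (lm i))).mul ((hratio η).comp hφ.tendsto_atTop)
    have hr0 : r ≠ 0 := by
      rintro rfl
      exact h.nonconst fun η => by simp [hlim η]
    have hw : Tendsto (fun n => (((c (φ n) * σ (φ n) ^ lm i : ℝ)) : ℂ)) atTop
        (𝓝 (g 0 * r ^ lm i / G (γ i))) := by
      refine Tendsto.congr' ?_ (((h.tendsto_zero.comp hφ.tendsto_atTop).mul (hr.pow (lm i))).div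
        (hGx.comp hφ.tendsto_atTop) hG0)
      filter_upwards [hφ.tendsto_atTop.eventually hne] with n ⟨h1, h2⟩
      simp only [Function.comp_apply, Pi.div_apply]
      rw [expRat_eq_mul_cofactor i, ← hG, div_pow]
      push_cast
      field_simp
    set w := g 0 * r ^ lm i / G (γ i) with hwdef
    have hw0 : w ≠ 0 := div_ne_zero (mul_ne_zero h.g_zero_ne (pow_ne_zero _ hr0)) hG0
    have hre : Tendsto (fun n => c (φ n) * σ (φ n) ^ lm i) atTop (𝓝 w.re) := by
      have := (continuous_re.tendsto _).comp hw
      exact this.congr fun n => ofReal_re _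
    have hwre : w = w.re := tendsto_nhds_unique hw ((continuous_ofReal.tendsto _).comp hre)
    have hpos : 0 ≤ w.re := by
      refine ge_of_tendsto hre ?_
      filter_upwards [(h.c_atTop.comp hφ.tendsto_atTop).eventually_ge_atTop 0] with n hn
      exact mul_nonneg hn (pow_nonneg (h.σ_pos _).le _)
    refine ⟨i, w.re, r⁻¹, lt_of_le_of_ne hpos fun h0 => hw0 ?_, fun η => ?_⟩
    · rw [hwre, ← h0, ofReal_zero]
    · rw [← hwre, hlim η, hwdef, mul_div_cancel₀ _ hG0, mul_assoc, ← mul_pow, mul_add,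
        mul_inv_cancel₀ hr0, add_comm]

lemma re_sq_div_nonpos (ha : a₂ ≠ 0) {b : ℂ} (hx : Tendsto (fun n => ‖x n‖) atTop atTop)
    (hb : Tendsto (fun n => σ n * (2 * a₂ * x n + a₁)) atTop (𝓝 b))
    (hne : ∀ᶠ n in atTop, expRat γ lm β jp a₂ a₁ a₀ (x n) ≠ 0)
    (h0 : Tendsto (fun n => expRat γ lm β jp a₂ a₁ a₀ (x n)) atTop (𝓝 0)) :
    (b ^ 2 / a₂).re ≤ 0 := by
  have hσC : Tendsto (fun n => (σ n : ℂ)) atTop (𝓝 0) := tendsto_zero_of_tendsto_mul_linear ha hx hb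
  have hσ : Tendsto σ atTop (𝓝 0) := by
    have := (continuous_re.tendsto _).comp hσC
    exact this.congr fun n => ofReal_re _
  have hσx : Tendsto (fun n => σ n * x n) atTop (𝓝 (b / (2 * a₂))) := by
    have := (hb.sub (hσC.mul_const a₁)).div_const (2 * a₂)
    rw [zero_mul, sub_zero] at this
    refine this.congr fun n => ?_
    field_simp
    ring
  have hP : Tendsto (fun n => (a₂ * x n ^ 2 + a₁ * x n + a₀).re * σ n ^ 2) atTop
      (𝓝 (b ^ 2 / a₂ / (4 : ℝ)).re) := by
    have h1 := (((hσx.pow 2).const_mul a₂).add ((hσC.mul hσx).const_mul a₁)).add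
      ((hσC.pow 2).const_mul a₀)
    have h2 : a₂ * (b / (2 * a₂)) ^ 2 + a₁ * (0 * (b / (2 * a₂))) + a₀ * 0 ^ 2 =
        b ^ 2 / a₂ / (4 : ℝ) := by
      push_cast
      field_simp
      ring
    rw [h2] at h1
    refine ((continuous_re.tendsto _).comp h1).congr fun n => ?_
    rw [Function.comp_apply, ← re_mul_ofReal]
    congr 1
    push_cast
    ring
  have hxne : ∀ᶠ n in atTop, x n ≠ 0 :=
    (hx.eventually_gt_atTop 0).mono fun n hn => norm_pos_iff.1 hn
  have hQ := tendsto_ratio_div_pow γ lm β jp one_ne_zero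
    (tendsto_const_nhds.congr' (hxne.mono fun n hn => (div_self hn).symm)) hx
  simp only [one_pow, div_one] at hQ
  have hlogQ : Tendsto (fun n => Real.log ‖rootProd γ lm (x n) / rootProd β jp (x n) /
      (x n ^ (∑ j, lm j) / x n ^ (∑ j, jp j))‖ * σ n ^ 2) atTop (𝓝 0) := by
    simpa using (hQ.norm.log (by simp)).mul (hσ.pow 2)
  have hlogx : Tendsto (fun n => Real.log ‖x n‖ * σ n ^ 2) atTop (𝓝 0) := by
    have hup : Tendsto (fun n => ‖x n‖ * σ n ^ 2) atTop (𝓝 0) := by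
      have := (hσC.mul hσx).norm
      simp only [zero_mul, norm_zero] at this
      refine this.congr fun n => ?_
      rw [norm_mul, norm_mul, norm_real, ← mul_assoc, ← sq, Real.norm_eq_abs, sq_abs, mul_comm]
    refine tendsto_of_tendsto_of_tendsto_of_le_of_le' tendsto_const_nhds hup ?_ ?_
    · filter_upwards [hx.eventually_ge_atTop 1] with n hn
      exact mul_nonneg (Real.log_nonneg hn) (sq_nonneg _)
    · filter_upwards with n
      gcongr
      exact Real.log_le_self (norm_nonneg _)
  have htot := hP.add (hlogQ.add (hlogx.const_mul ((∑ j, lm j : ℕ) - (∑ j, jp j : ℕ) : ℝ)))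
  rw [mul_zero, add_zero, add_zero, div_ofReal_re] at htot
  have : (b ^ 2 / a₂).re / 4 ≤ 0 := by
    refine le_of_tendsto htot ?_
    have hle : ∀ᶠ n in atTop, ‖expRat γ lm β jp a₂ a₁ a₀ (x n)‖ < 1 :=
      h0.norm.eventually_lt_const (by simp)
    filter_upwards [hxne, hne, hle, hQ.eventually_ne one_ne_zero] with n hxn hfn hfn1 hQn
    have hlog := Real.log_nonpos (norm_nonneg _) hfn1.le
    have hs := div_ne_zero (pow_ne_zero (∑ j, lm j) hxn) (pow_ne_zero (∑ j, jp j) hxn)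
    have hR : rootProd γ lm (x n) / rootProd β jp (x n) = rootProd γ lm (x n) /
        rootProd β jp (x n) / (x n ^ (∑ j, lm j) / x n ^ (∑ j, jp j)) *
          (x n ^ (∑ j, lm j) / x n ^ (∑ j, jp j)) := (div_mul_cancel₀ _ hs).symm
    have hxn' := norm_ne_zero_iff.2 hxn
    rw [norm_expRat, hR, norm_mul, Real.log_mul (mul_ne_zero (norm_ne_zero_iff.2 hQn)
      (norm_ne_zero_iff.2 hs)) (Real.exp_ne_zero _), Real.log_exp, Real.log_mul
      (norm_ne_zero_iff.2 hQn) (norm_ne_zero_iff.2 hs), norm_div (x n ^ _), norm_pow, norm_pow,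
      Real.log_div (pow_ne_zero _ hxn') (pow_ne_zero _ hxn'), Real.log_pow, Real.log_pow] at hlog
    nlinarith [mul_nonpos_of_nonpos_of_nonneg hlog (sq_nonneg (σ n))]
  linarith

lemma RescaledLimit.eq_exp (ha : a₂ ≠ 0)
    (h : RescaledLimit (expRat γ lm β jp a₂ a₁ a₀) c x σ g)
    (hx : Tendsto (fun n => ‖x n‖) atTop atTop)
    (hq : Tendsto (fun n => ‖x n / σ n‖) atTop atTop) :
    ∃ b : ℂ, b ≠ 0 ∧ (b ^ 2 / a₂).re ≤ 0 ∧ ∀ η, g η = g 0 * exp (b * η) := by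
  have hlin := tendsto_norm_linear_atTop (a₁ := a₁) ha hx
  rcases tendsto_norm_atTop_or_exists_subseq (fun n => σ n * (2 * a₂ * x n + a₁)) with
    hb | ⟨b, φ, hφ, hb⟩
  · exfalso
    set B : ℕ → ℂ := fun n => σ n * (2 * a₂ * x n + a₁) with hB
    have hB0 : ∀ᶠ n in atTop, ‖B n‖ ≠ 0 := (hb.eventually_gt_atTop 0).mono fun n hn => hn.ne'
    obtain ⟨u, -, φ, hφ, hu⟩ := tendsto_subseq_of_bounded
      (Metric.isBounded_closedBall (x := (0 : ℂ)) (r := 1)) (x := fun n => B n / ‖B n‖) fun n => by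
        simpa using div_self_le_one ‖B n‖
    have hu0 : ‖u‖ = 1 := by
      refine tendsto_nhds_unique hu.norm (tendsto_const_nhds.congr' ?_)
      filter_upwards [hφ.tendsto_atTop.eventually hB0] with n hn
      simp [hn]
    refine h.not_atTop φ hφ {η | 0 < (u * η).re} (isOpen_lt continuous_const (by fun_prop))
      ⟨(starRingEnd ℂ) u, ?_⟩ fun η hη => ?_
    · rw [Set.mem_ofPred_eq, mul_conj, ofReal_re, normSq_eq_norm_sq, hu0]
      norm_num
    have hxφ := hx.comp hφ.tendsto_atTop
    have hxne : ∀ᶠ n in atTop, x n ≠ 0 :=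
      (hx.eventually_gt_atTop 0).mono fun n hn => norm_pos_iff.1 hn
    have hsx : Tendsto (fun n => σ n / x n) atTop (𝓝 0) := by
      simpa using tendsto_inv_of_norm_atTop hq
    have hy : Tendsto (fun n => (x n + σ n * η) / x n) atTop (𝓝 1) := by
      have := (hsx.mul_const η).const_add 1
      rw [zero_mul, add_zero] at this
      refine this.congr' (hxne.mono fun n hn => ?_)
      field_simp
    have hsB : Tendsto (fun n => (σ n : ℂ) ^ 2 / ‖B n‖) atTop (𝓝 0) := by
      have h1 := (hsx.mul ((((tendsto_inv_of_norm_atTop hx).const_mul a₁).const_add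
        (2 * a₂)).inv₀ (by simpa using ha))).norm
      rw [zero_mul, norm_zero] at h1
      rw [tendsto_zero_iff_norm_tendsto_zero]
      refine h1.congr' ?_
      filter_upwards [hxne, hB0] with n hn hBn
      have hσ0 := h.σ_pos n
      have hlinn : 2 * a₂ * x n + a₁ ≠ 0 := fun h0 => hBn (by simp [hB, h0])
      have : (σ n : ℂ) / x n * (2 * a₂ + a₁ * (x n)⁻¹)⁻¹ = σ n / (2 * a₂ * x n + a₁) := by
        have h2 : 2 * a₂ + a₁ * (x n)⁻¹ = (2 * a₂ * x n + a₁) / x n := by field_simp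
        rw [h2]
        field_simp
      rw [this]
      simp only [hB, norm_div, norm_mul, norm_real, norm_pow, norm_norm, Real.norm_of_nonneg hσ0.le]
      have := norm_ne_zero_iff.2 hlinn
      field_simp
    have hexp : Tendsto (fun n => ‖B (φ n)‖ * (B (φ n) / ‖B (φ n)‖ * η +
        a₂ * ((σ (φ n) : ℂ) ^ 2 / ‖B (φ n)‖) * η ^ 2).re) atTop atTop := by
      refine (hb.comp hφ.tendsto_atTop).atTop_mul_pos hη ?_
      have h1 := (hu.mul_const η).add
        (((hsB.comp hφ.tendsto_atTop).const_mul a₂).mul_const (η ^ 2))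
      rw [mul_zero, zero_mul, add_zero] at h1
      exact (continuous_re.tendsto _).comp h1
    have hfin := ((h.tendsto_zero.comp hφ.tendsto_atTop).norm.mul
      ((tendsto_ratio_div_ratio γ lm β jp hx hy).comp hφ.tendsto_atTop).norm).pos_mul_atTop
      (by simpa using h.g_zero_ne) (Real.tendsto_exp_atTop.comp hexp)
    refine hfin.congr' ?_
    filter_upwards [hφ.tendsto_atTop.eventually h.eventually_f_ne_zero,
      hφ.tendsto_atTop.eventually hB0] with n hn hBn
    have hBC : (‖B (φ n)‖ : ℂ) ≠ 0 := ofReal_ne_zero.2 hBn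
    have hE := expRat_div_expRat (γ := γ) (lm := lm) (β := β) (jp := jp) (a₂ := a₂) (a₁ := a₁)
      (a₀ := a₀) (x (φ n)) (σ (φ n) * η)
    rw [div_eq_iff hn] at hE
    simp only [Function.comp_apply]
    rw [hE, ← re_ofReal_mul, ← norm_exp, ← norm_mul, ← norm_mul]
    congr 1
    have : (‖B (φ n)‖ : ℂ) * (B (φ n) / ‖B (φ n)‖ * η +
        a₂ * ((σ (φ n) : ℂ) ^ 2 / ‖B (φ n)‖) * η ^ 2) =
        σ (φ n) * η * (2 * a₂ * x (φ n) + a₁) + a₂ * (σ (φ n) * η) ^ 2 := by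
      field_simp
      simp only [hB]
      ring
    rw [this]
    ring
  · have hlim : ∀ η, g η = g 0 * exp (b * η) := by
      intro η
      refine h.eq_lim φ hφ η _ ?_
      refine Tendsto.congr' ?_ ((h.tendsto_zero.comp hφ.tendsto_atTop).mul
        (tendsto_expRat_div (γ := γ) (lm := lm) (β := β) (jp := jp) (a₀ := a₀) ha
          (hx.comp hφ.tendsto_atTop) hb (tendsto_const_nhds (x := η))))
      filter_upwards [hφ.tendsto_atTop.eventually h.eventually_f_ne_zero] with n hn
      simp only [Function.comp_apply]
      field_simp
    refine ⟨b, ?_, ?_, hlim⟩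
    · rintro rfl
      exact h.nonconst fun η => by simp [hlim η]
    · exact re_sq_div_nonpos (γ := γ) (lm := lm) (β := β) (jp := jp) (a₀ := a₀) ha
        (hx.comp hφ.tendsto_atTop) hb (hφ.tendsto_atTop.eventually h.eventually_f_ne_zero)
        (h.tendsto_f.comp hφ.tendsto_atTop)

lemma RescaledLimit.eq_pow_or_eq_exp (ha : a₂ ≠ 0) (hγ : Function.Injective γ)
    (hγβ : ∀ i j, γ i ≠ β j) (hlm : ∀ i, 1 ≤ lm i)
    (h : RescaledLimit (expRat γ lm β jp a₂ a₁ a₀) c x σ g) :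
    (∃ (i : Fin m) (t : ℝ) (C : ℂ), 0 < t ∧ ∀ η, g η =
      expRatCofactor γ lm β jp a₂ a₁ a₀ i (γ i) * t * (η + C) ^ lm i) ∨
    ∃ b : ℂ, b ≠ 0 ∧ (b ^ 2 / a₂).re ≤ 0 ∧ ∀ η, g η = g 0 * exp (b * η) := by
  have hre : ∀ {s : ℕ → ℝ} {a : ℂ}, Tendsto (fun n => (s n : ℂ)) atTop (𝓝 a) →
      Tendsto s atTop (𝓝 a.re) := fun hs =>
    ((continuous_re.tendsto _).comp hs).congr fun n => ofReal_re _
  rcases tendsto_norm_atTop_or_exists_subseq (fun n => x n / σ n) with hq | ⟨q, φ, hφ, hq⟩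
  · rcases tendsto_norm_atTop_or_exists_subseq x with hx | ⟨x₀, φ, hφ, hx⟩
    · exact Or.inr (h.eq_exp ha hx hq)
    · have hσ : Tendsto (fun n => ((σ ∘ φ) n : ℂ)) atTop (𝓝 0) := by
        have := hx.mul (tendsto_inv_of_norm_atTop (hq.comp hφ.tendsto_atTop))
        rw [mul_zero] at this
        refine this.congr' ?_
        filter_upwards [(hq.comp hφ.tendsto_atTop).eventually_gt_atTop 0] with n hn
        have hn' : x (φ n) ≠ 0 := by
          rintro h0
          simp [h0] at hn
        have := (h.comp hφ).σ_pos n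
        simp only [Function.comp_apply]
        field_simp
      exact Or.inl ((h.comp hφ).eq_pow hγ hγβ hlm (hre hσ) hx)
  · have h' := h.comp hφ
    rcases tendsto_norm_atTop_or_exists_subseq (fun n => ((σ ∘ φ) n : ℂ)) with hs | ⟨s, ψ, hψ, hs⟩
    · refine (h'.false_of_scale_atTop ha ?_ hq).elim
      refine hs.congr fun n => ?_
      rw [norm_real, Real.norm_of_nonneg (h'.σ_pos n).le]
    · have h'' := h'.comp hψ
      have hσ := hre hs
      have hx : Tendsto ((x ∘ φ) ∘ ψ) atTop (𝓝 (q * s)) := by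
        refine ((hq.comp hψ.tendsto_atTop).mul hs).congr fun n => ?_
        exact div_mul_cancel₀ _ (ofReal_ne_zero.2 (h''.σ_pos n).ne')
      rcases (ge_of_tendsto' hσ fun n => (h''.σ_pos n).le).eq_or_lt with h0 | h0
      · rw [← h0] at hσ
        exact Or.inl (h''.eq_pow hγ hγβ hlm hσ hx)
      · exact (h''.false_of_scale_tendsto_pos h0 hσ hx).elim

lemma tendsto_rpow_neg_atTop_of_tendsto_zero {α : ℝ} (hα : 0 < α) {ρ : ℕ → ℝ}
    (hρ : ∀ n, 0 < ρ n) (h0 : Tendsto ρ atTop (𝓝 0)) :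
    Tendsto (fun n => ρ n ^ (-α)) atTop atTop := by
  have h1 : Tendsto ρ atTop (𝓝[>] 0) :=
    tendsto_nhdsWithin_iff.2 ⟨h0, Eventually.of_forall hρ⟩
  refine ((tendsto_rpow_atTop hα).comp (tendsto_inv_nhdsGT_zero.comp h1)).congr fun n => ?_
  rw [Function.comp_apply, Function.comp_apply, Real.inv_rpow (hρ n).le, Real.rpow_neg (hρ n).le]

lemma exists_rescaledLimit_of_mem_piAlpha {α : ℝ} (hα : 0 < α)
    (hg : g ∈ PiAlpha α (expRat γ lm β jp a₂ a₁ a₀)) :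
    ∃ ζ₀ c x σ, RescaledLimit (expRat γ lm β jp a₂ a₁ a₀) c x σ (fun η => g (ζ₀ + η)) := by
  obtain ⟨hmer, hnc, z₀, k, z, ρ, hk, -, hρ, hρ0, H⟩ := hg
  obtain ⟨ζ₀, hζ₀⟩ : ∃ ζ₀, g ζ₀ ≠ 0 := by
    by_contra! hcon
    exact hnc 0 (funext hcon)
  obtain ⟨N, hN⟩ := eventually_atTop.1 (hk.eventually_gt_atTop 0)
  have hshift : StrictMono fun n : ℕ => n + N := fun a b hab => by simpa using hab
  have heq : ∀ n η, (k n : ℂ) * z n + k n * ρ n * (ζ₀ + η) =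
      (k n * z n + k n * ρ n * ζ₀) + ((k n * ρ n : ℝ) : ℂ) * η := by
    intro n η
    push_cast
    ring
  have hcont : ∀ n ζ, ((ρ n ^ (-α) : ℝ) : ℂ) * expRat γ lm β jp a₂ a₁ a₀
      ((k n : ℂ) * z n + (k n : ℂ) * (ρ n : ℂ) * ζ) ≠ 0 →
      ContinuousAt (fun ζ => ((ρ n ^ (-α) : ℝ) : ℂ) * expRat γ lm β jp a₂ a₁ a₀
      ((k n : ℂ) * z n + (k n : ℂ) * (ρ n : ℂ) * ζ)) ζ := by
    intro n ζ hne
    refine continuousAt_const.mul (ContinuousAt.comp'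
      (continuousAt_expRat_of_ne_zero (right_ne_zero_of_mul hne)) ?_)
    fun_prop
  refine ⟨ζ₀, fun n => ρ (n + N) ^ (-α),
    fun n => (k (n + N) * z (n + N) + k (n + N) * ρ (n + N) * ζ₀),
    fun n => k (n + N) * ρ (n + N), ?_, ?_, ?_, ?_, ?_, ?_, ?_⟩
  · exact (tendsto_rpow_neg_atTop_of_tendsto_zero hα hρ hρ0).comp hshift.tendsto_atTop
  · exact fun n => mul_pos (Nat.cast_pos.2 (hN _ (Nat.le_add_left N n))) (hρ _)
  · simpa using hζ₀
  · simpa using (H.comp hshift).tendsto_of_ne_zero hζ₀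
  · intro φ hφ η d hd
    simp only [← heq] at hd
    exact ((H.comp hshift).comp hφ).eq_of_tendsto hd
  · intro φ hφ U hU hUne hinf
    simp only [← heq] at hinf
    refine hζ₀ (((H.comp hshift).comp hφ).eq_zero_of_eqOn_open (fun n => hcont _) hmer
      (hU.preimage (f := fun ζ => ζ - ζ₀) (by fun_prop)) ?_ (fun ζ hζ => ?_) ζ₀)
    · obtain ⟨u, hu⟩ := hUne
      exact ⟨ζ₀ + u, by simpa using hu⟩
    · refine ((H.comp hshift).comp hφ).eq_zero_of_tendsto_norm_atTop ?_
      simpa using hinf _ hζ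
  · intro hconst
    refine hnc (g ζ₀) (funext fun ζ => ?_)
    simpa using hconst (ζ - ζ₀)

end Cases

lemma re_sq_div_polar {a : ℂ} {φ : ℝ} (ha : a = (‖a‖ : ℂ) * exp (φ * I)) (t θ : ℝ) :
    (((t : ℂ) * exp (θ * I)) ^ 2 / a).re = t ^ 2 / ‖a‖ * Real.cos (2 * θ - φ) := by
  have : ((t : ℂ) * exp (θ * I)) ^ 2 / a =
      ((t ^ 2 / ‖a‖ : ℝ) : ℂ) * exp ((2 * θ - φ : ℝ) * I) := by
    conv_lhs => rw [ha]
    have : ((2 * θ - φ : ℝ) : ℂ) * I = (θ * I + θ * I) - φ * I := by push_cast; ring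
    rw [this, exp_sub, exp_add]
    push_cast
    ring
  rw [this, re_ofReal_mul, exp_ofReal_mul_I_re]

/-- Polar form of the condition `Re (b ^ 2 / a) ≤ 0`. -/
lemma re_sq_div_nonpos_iff_exists_polar {a b : ℂ} {φ : ℝ} (ha : a ≠ 0)
    (hφ : a = (‖a‖ : ℂ) * exp (φ * I)) :
    (b ≠ 0 ∧ (b ^ 2 / a).re ≤ 0) ↔
      ∃ t θ : ℝ, 0 < t ∧
        ((Real.pi / 4 + φ / 2 ≤ θ ∧ θ ≤ 3 * Real.pi / 4 + φ / 2) ∨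
          (5 * Real.pi / 4 + φ / 2 ≤ θ ∧ θ ≤ 7 * Real.pi / 4 + φ / 2)) ∧
        b = (t : ℂ) * exp ((θ : ℝ) * I) := by
  have ha' := norm_pos_iff.2 ha
  have hpi := Real.pi_pos
  constructor
  · rintro ⟨hb, hre⟩
    set θ := toIcoMod Real.two_pi_pos (φ / 2) (arg b) with hθ
    have hmem := toIcoMod_mem_Ico Real.two_pi_pos (φ / 2) (arg b)
    rw [← hθ] at hmem
    have hbθ : b = (‖b‖ : ℂ) * exp (θ * I) := by
      conv_lhs => rw [← norm_mul_exp_arg_mul_I b]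
      congr 1
      rw [exp_eq_exp_iff_exists_int]
      refine ⟨toIcoDiv Real.two_pi_pos (φ / 2) (arg b), ?_⟩
      rw [hθ, toIcoMod]
      push_cast [zsmul_eq_mul]
      ring
    refine ⟨‖b‖, θ, norm_pos_iff.2 hb, ?_, hbθ⟩
    rw [hbθ, re_sq_div_polar hφ] at hre
    have hcos : Real.cos (2 * θ - φ) ≤ 0 := by
      by_contra! hc
      have : 0 < ‖b‖ ^ 2 / ‖a‖ := by positivity
      nlinarith [mul_pos this hc]
    obtain ⟨h1, h2⟩ := hmem
    by_contra! hcon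
    obtain ⟨h3, h4⟩ := hcon
    refine absurd hcos (not_le.2 ?_)
    by_cases h5 : Real.pi / 4 + φ / 2 ≤ θ
    · by_cases h6 : 5 * Real.pi / 4 + φ / 2 ≤ θ
      · rw [← Real.cos_sub_two_pi, ← Real.cos_sub_two_pi]
        exact Real.cos_pos_of_mem_Ioo ⟨by linarith [h4 h6], by linarith⟩
      · rw [← Real.cos_sub_two_pi]
        exact Real.cos_pos_of_mem_Ioo ⟨by linarith [h3 h5], by linarith⟩
    · exact Real.cos_pos_of_mem_Ioo ⟨by linarith, by linarith⟩
  · rintro ⟨t, θ, ht, hθ, rfl⟩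
    refine ⟨mul_ne_zero (ofReal_ne_zero.2 ht.ne') (exp_ne_zero _), ?_⟩
    rw [re_sq_div_polar hφ]
    refine mul_nonpos_of_nonneg_of_nonpos (by positivity) ?_
    rcases hθ with ⟨h1, h2⟩ | ⟨h1, h2⟩
    · exact Real.cos_nonpos_of_pi_div_two_le_of_le (by linarith) (by linarith)
    · rw [← Real.cos_sub_two_pi]
      exact Real.cos_nonpos_of_pi_div_two_le_of_le (by linarith) (by linarith)

section Construction

variable {m p : ℕ} {γ : Fin m → ℂ} {lm : Fin m → ℕ} {β : Fin p → ℂ} {jp : Fin p → ℕ}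
  {a₂ a₁ a₀ : ℂ} {α : ℝ}

lemma pow_mem_piAlpha (hγ : Function.Injective γ) (hγβ : ∀ i j, γ i ≠ β j) (hlm : ∀ i, 1 ≤ lm i)
    (hα₁ : 0 < α) (hα₂ : α < 1) (i : Fin m) {t : ℝ} (ht : 0 < t) (C : ℂ) :
    (fun ζ => expRatCofactor γ lm β jp a₂ a₁ a₀ i (γ i) * t * (ζ + C) ^ lm i) ∈
      PiAlpha α (expRat γ lm β jp a₂ a₁ a₀) := by
  have hl0 : lm i ≠ 0 := by have := hlm i; omega
  have hG0 : expRatCofactor γ lm β jp a₂ a₁ a₀ i (γ i) ≠ 0 := expRatCofactor_ne_zero hγ hγβ i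
  have hl : (1 : ℝ) ≤ lm i := by exact_mod_cast hlm i
  have hlα : 0 < (lm i : ℝ) - α := by linarith
  set k : ℕ → ℕ := fun n => n + 1
  have hk : Tendsto k atTop atTop := tendsto_add_atTop_nat 1
  have hkR : Tendsto (fun n => (k n : ℝ)) atTop atTop := tendsto_natCast_atTop_atTop.comp hk
  have hk0 : ∀ n, (0 : ℝ) < k n := fun n => by positivity
  set ρ : ℕ → ℝ := fun n => (t * ((k n : ℝ) ^ lm i)⁻¹) ^ ((lm i : ℝ) - α)⁻¹ with hρdef
  have hρ : ∀ n, 0 < ρ n := fun n => by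
    have := hk0 n
    positivity
  have hρ0 : Tendsto ρ atTop (𝓝 0) := by
    have h1 : Tendsto (fun n => t * ((k n : ℝ) ^ lm i)⁻¹) atTop (𝓝 0) := by
      simpa using (((tendsto_pow_atTop hl0).comp hkR).inv_tendsto_atTop).const_mul t
    have h2 := h1.rpow_const (p := ((lm i : ℝ) - α)⁻¹) (Or.inr (by positivity))
    rwa [Real.zero_rpow (by positivity)] at h2
  have hbal : ∀ n, ρ n ^ (-α) * (k n * ρ n) ^ lm i = t := by
    intro n
    have hkn := hk0 n
    have h1 : ρ n ^ (-α) * ρ n ^ lm i = t * ((k n : ℝ) ^ lm i)⁻¹ := by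
      rw [← Real.rpow_natCast (ρ n), ← Real.rpow_add (hρ n), neg_add_eq_sub, hρdef]
      simp only
      rw [← Real.rpow_mul (by positivity), inv_mul_cancel₀ hlα.ne', Real.rpow_one]
    rw [mul_pow, mul_left_comm, h1]
    field_simp
  have hσ : Tendsto (fun n => k n * ρ n) atTop (𝓝 0) := by
    have h1 : Tendsto (fun n => (k n * ρ n) ^ lm i) atTop (𝓝 0) := by
      have h2 := (tendsto_rpow_neg_atTop_of_tendsto_zero hα₁ hρ hρ0).inv_tendsto_atTop.const_mul t
      rw [mul_zero] at h2
      refine h2.congr fun n => ?_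
      have := Real.rpow_pos_of_pos (hρ n) (-α)
      rw [← hbal n, Pi.inv_apply]
      field_simp
    have h3 := h1.rpow_const (p := ((lm i : ℝ))⁻¹) (Or.inr (by positivity))
    rw [Real.zero_rpow (by positivity)] at h3
    refine h3.congr fun n => ?_
    exact Real.pow_rpow_inv_natCast (mul_pos (hk0 n) (hρ n)).le hl0
  have hσC : Tendsto (fun n => (k n : ℂ) * ρ n) atTop (𝓝 0) := by
    rw [← ofReal_zero]
    exact ((continuous_ofReal.tendsto _).comp hσ).congr fun n => by simp
  refine ⟨?_, ?_, 0, k, fun n => γ i * (k n : ℂ)⁻¹ + ρ n * C, ρ, hk, ?_, hρ, hρ0, ?_⟩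
  · intro ζ _
    fun_prop
  · intro c hc
    have h1 := congrFun hc (-C)
    have h2 := congrFun hc (1 - C)
    simp only [neg_add_cancel, zero_pow hl0, mul_zero, sub_add_cancel, one_pow, mul_one] at h1 h2
    rw [← h1] at h2
    exact mul_ne_zero hG0 (ofReal_ne_zero.2 ht.ne') h2
  · have h1 : Tendsto (fun n => (k n : ℂ)⁻¹) atTop (𝓝 0) :=
      (tendsto_inv_of_norm_atTop (tendsto_norm_ofReal_atTop hkR)).congr fun n => by simp
    have h2 : Tendsto (fun n => (ρ n : ℂ)) atTop (𝓝 0) := by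
      rw [← ofReal_zero]
      exact (continuous_ofReal.tendsto _).comp hρ0
    simpa using (h1.const_mul (γ i)).add (h2.mul_const C)
  · refine sphLocUnifConv_of_tendsto_prod (by fun_prop) fun ζ => ?_
    have hs : Tendsto (fun q : ℕ × ℂ => q.2 + C) (atTop ×ˢ 𝓝 ζ) (𝓝 (ζ + C)) :=
      tendsto_snd.add_const C
    have hy : Tendsto (fun q : ℕ × ℂ => γ i + k q.1 * ρ q.1 * (q.2 + C)) (atTop ×ˢ 𝓝 ζ)
        (𝓝 (γ i)) := by
      simpa using ((hσC.comp tendsto_fst).mul hs).const_add (γ i)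
    have hG := (continuousAt_expRatCofactor (lm := lm) (jp := jp) (a₂ := a₂) (a₁ := a₁) (a₀ := a₀)
      hγβ i).tendsto.comp hy
    refine ((hG.mul_const (t : ℂ)).mul (hs.pow (lm i))).congr fun q => ?_
    have hkq : (k q.1 : ℂ) ≠ 0 := Nat.cast_ne_zero.2 (Nat.succ_ne_zero _)
    have hq : (k q.1 : ℂ) * (γ i * (k q.1 : ℂ)⁻¹ + ρ q.1 * C) + k q.1 * ρ q.1 * q.2 =
        γ i + k q.1 * ρ q.1 * (q.2 + C) := by
      field_simp
      ring
    rw [Function.comp_apply, hq, expRat_eq_mul_cofactor i, add_sub_cancel_left,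
      mul_pow ((k q.1 : ℂ) * ρ q.1)]
    conv_lhs => rw [← hbal q.1]
    push_cast
    ring

lemma exists_seq_exp_quadratic_eq_of_nonneg {A : ℝ} (hA : 0 ≤ A) (y : ℝ) :
    ∃ s : ℕ → ℝ, (∀ n, 1 ≤ s n) ∧ Tendsto s atTop atTop ∧
      ∀ n, exp (((A * s n ^ 2 + s n : ℝ) : ℂ) * I) = exp (y * I) := by
  have key : ∀ n : ℕ, ∃ s : ℝ, (n : ℝ) + 1 ≤ s ∧
      exp (((A * s ^ 2 + s : ℝ) : ℂ) * I) = exp (y * I) := by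
    intro n
    have hlim : Tendsto (fun s : ℝ => A * s ^ 2 + s) atTop atTop :=
      tendsto_atTop_mono (fun s => le_add_of_nonneg_left (mul_nonneg hA (sq_nonneg s))) tendsto_id
    have hsub := isPreconnected_Ici.intermediate_value_Ici (s := Set.Ici ((n : ℝ) + 1))
      (l := atTop) (a := (n : ℝ) + 1) Set.self_mem_Ici (le_principal_iff.2 (Ici_mem_atTop _))
      (f := fun s : ℝ => A * s ^ 2 + s) (by fun_prop) hlim
    obtain ⟨N, hN⟩ := exists_nat_ge ((A * ((n : ℝ) + 1) ^ 2 + ((n : ℝ) + 1) - y) / (2 * Real.pi))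
    rw [div_le_iff₀ Real.two_pi_pos] at hN
    obtain ⟨s, hs, hsy⟩ := hsub (show y + N * (2 * Real.pi) ∈ Set.Ici _ by
      simp only [Set.mem_Ici]
      linarith)
    refine ⟨s, hs, ?_⟩
    simp only at hsy
    rw [hsy, exp_eq_exp_iff_exists_int]
    refine ⟨N, ?_⟩
    push_cast
    ring
  choose s hs hsy using key
  refine ⟨s, fun n => ?_, ?_, hsy⟩
  · have := hs n
    have : (0 : ℝ) ≤ n := n.cast_nonneg
    linarith
  · exact tendsto_atTop_mono hs (tendsto_atTop_add_const_right _ _ tendsto_natCast_atTop_atTop)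

lemma exists_seq_exp_quadratic_eq (A : ℝ) :
    ∃ τ : ℝ, ∀ y : ℝ, ∃ s : ℕ → ℝ, (∀ n, 1 ≤ s n) ∧ Tendsto s atTop atTop ∧
      ∀ n, exp (((A * s n ^ 2 + τ * s n : ℝ) : ℂ) * I) = exp (y * I) := by
  rcases le_total 0 A with hA | hA
  · refine ⟨1, fun y => ?_⟩
    simpa using exists_seq_exp_quadratic_eq_of_nonneg hA y
  · refine ⟨-1, fun y => ?_⟩
    obtain ⟨s, h1, h2, h3⟩ := exists_seq_exp_quadratic_eq_of_nonneg (neg_nonneg.2 hA) (-y)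
    refine ⟨s, h1, h2, fun n => ?_⟩
    have := congrArg (·⁻¹) (h3 n)
    simp only [← exp_neg] at this
    convert this using 2 <;> push_cast <;> ring

lemma exists_nat_seq_rpow_asymptotic (hα₁ : 0 < α) (hα₂ : α < 1) {s T : ℕ → ℝ}
    (hs : ∀ n, 1 ≤ s n) (hT : ∀ n, 0 < T n)
    (hTs : Tendsto (fun n => T n / s n ^ 2) atTop atTop) :
    ∃ k : ℕ → ℕ, (∀ n, 0 < k n) ∧ Tendsto k atTop atTop ∧
      Tendsto (fun n => s n / k n) atTop (𝓝 0) ∧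
      Tendsto (fun n => (s n * k n) ^ α / T n) atTop (𝓝 1) := by
  have hs0 : ∀ n, 0 < s n := fun n => zero_lt_one.trans_le (hs n)
  set κ : ℕ → ℝ := fun n => T n ^ α⁻¹ / s n with hκdef
  have hκ0 : ∀ n, 0 < κ n := fun n => div_pos (Real.rpow_pos_of_pos (hT n) _) (hs0 n)
  have hκs : Tendsto (fun n => κ n / s n) atTop atTop := by
    refine tendsto_atTop_mono' _ ?_ hTs
    filter_upwards [hTs.eventually_ge_atTop 1] with n hn
    have hsn := hs n
    have hT1 : 1 ≤ T n := by
      rw [le_div_iff₀ (pow_pos (hs0 n) 2)] at hn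
      nlinarith
    have hle := Real.self_le_rpow_of_one_le hT1 ((one_le_inv₀ hα₁).2 hα₂.le)
    rw [hκdef]
    simp only
    rw [div_div, ← sq]
    gcongr
  have hκ : Tendsto κ atTop atTop :=
    tendsto_atTop_mono (fun n => div_le_self (hκ0 n).le (hs n)) hκs
  refine ⟨fun n => ⌈κ n⌉₊, fun n => Nat.ceil_pos.2 (hκ0 n), tendsto_nat_ceil_atTop.comp hκ, ?_, ?_⟩
  · refine squeeze_zero (fun n => div_nonneg (hs0 n).le (Nat.cast_nonneg _)) (fun n => ?_)
      hκs.inv_tendsto_atTop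
    rw [Pi.inv_apply, inv_div]
    exact div_le_div_of_nonneg_left (hs0 n).le (hκ0 n) (Nat.le_ceil _)
  · have h1 : Tendsto (fun n => ((⌈κ n⌉₊ : ℝ) / κ n) ^ α) atTop (𝓝 (1 ^ α)) :=
      (tendsto_nat_ceil_div_atTop.comp hκ).rpow_const (Or.inr hα₁.le)
    rw [Real.one_rpow] at h1
    refine h1.congr fun n => ?_
    have hTn : T n = (s n * κ n) ^ α := by
      simp only [hκdef]
      rw [mul_div_cancel₀ _ (hs0 n).ne', Real.rpow_inv_rpow (hT n).le hα₁.ne']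
    conv_rhs => rw [hTn]
    rw [← Real.div_rpow (mul_nonneg (hs0 n).le (Nat.cast_nonneg _))
      (mul_pos (hs0 n) (hκ0 n)).le, mul_div_mul_left _ _ (hs0 n).ne']

lemma tendsto_pow_div_pow_mul_exp_div_sq {e r : ℝ} (he : 0 < e) (hr : 0 ≤ r) (N M : ℕ)
    {s : ℕ → ℝ} (hs : ∀ n, 1 ≤ s n) (hsT : Tendsto s atTop atTop) :
    Tendsto (fun n => e * (s n ^ M / s n ^ N) * Real.exp (s n + r * s n ^ 2) / s n ^ 2)
      atTop atTop := by
  refine tendsto_atTop_mono (fun n => ?_)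
    (((Real.tendsto_exp_div_pow_atTop (N + 2)).comp hsT).const_mul_atTop he)
  have hs0 : 0 < s n := zero_lt_one.trans_le (hs n)
  have h1 : Real.exp (s n) ≤ s n ^ M * Real.exp (s n + r * s n ^ 2) :=
    calc Real.exp (s n) ≤ Real.exp (s n + r * s n ^ 2) :=
          Real.exp_le_exp.2 (le_add_of_nonneg_right (by positivity))
      _ ≤ _ := le_mul_of_one_le_left (Real.exp_pos _).le (one_le_pow₀ (hs n))
  calc e * (Real.exp (s n) / s n ^ (N + 2))
      ≤ e * (s n ^ M * Real.exp (s n + r * s n ^ 2) / s n ^ (N + 2)) := by gcongr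
    _ = _ := by
      rw [pow_add]
      field_simp

lemma exists_exp_scaling (ha : a₂ ≠ 0) (hα₁ : 0 < α) (hα₂ : α < 1) {b : ℂ} (hb : b ≠ 0)
    (hre : (b ^ 2 / a₂).re ≤ 0) (A₀ : ℂ) :
    ∃ (s : ℕ → ℝ) (x : ℕ → ℂ) (k : ℕ → ℕ), (∀ n, 0 < s n) ∧ (∀ n, 0 < k n) ∧
      Tendsto s atTop atTop ∧ Tendsto k atTop atTop ∧ Tendsto (fun n => ‖x n‖) atTop atTop ∧
      Tendsto (fun n => x n / k n) atTop (𝓝 0) ∧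
      Tendsto (fun n => ((s n)⁻¹ : ℂ) * (2 * a₂ * x n + a₁)) atTop (𝓝 b) ∧
      Tendsto (fun n => (((s n * k n) ^ α : ℝ) : ℂ) * expRat γ lm β jp a₂ a₁ a₀ (x n)) atTop
        (𝓝 (exp A₀)) := by
  set N := ∑ j, lm j
  set M := ∑ j, jp j
  set L := b / (2 * a₂) with hLdef
  have hL : L ≠ 0 := div_ne_zero hb (mul_ne_zero two_ne_zero ha)
  have hLL : L ^ N / L ^ M ≠ 0 := div_ne_zero (pow_ne_zero _ hL) (pow_ne_zero _ hL)
  set c₂ := b ^ 2 / a₂ / (4 : ℝ) with hc₂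
  have hr : 0 ≤ -c₂.re := by
    rw [hc₂, div_ofReal_re]
    linarith
  obtain ⟨τ, hτ⟩ := exists_seq_exp_quadratic_eq c₂.im
  set d := (-1 + τ * I - a₁ * L) / b with hd
  set c₀ := a₂ * d ^ 2 + a₁ * d + a₀ with hc₀
  set E := exp A₀ / (L ^ N / L ^ M * exp c₀) with hE
  have hE0 : E ≠ 0 := div_ne_zero (exp_ne_zero _) (mul_ne_zero hLL (exp_ne_zero _))
  obtain ⟨s, hs1, hsT, hphase⟩ := hτ (arg E)
  have hs0 : ∀ n, 0 < s n := fun n => zero_lt_one.trans_le (hs1 n)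
  have hsC : ∀ n, (s n : ℂ) ≠ 0 := fun n => ofReal_ne_zero.2 (hs0 n).ne'
  have hsN := tendsto_norm_ofReal_atTop hsT
  have hsinv := tendsto_inv_of_norm_atTop hsN
  set T : ℕ → ℝ := fun n => ‖E‖ * (s n ^ M / s n ^ N) * Real.exp (s n + -c₂.re * s n ^ 2) with hTdef
  have hT0 : ∀ n, 0 < T n := fun n => by
    have := hs0 n
    have := norm_pos_iff.2 hE0
    positivity
  obtain ⟨k, hk0, hkT, hsk, hskT⟩ := exists_nat_seq_rpow_asymptotic hα₁ hα₂ hs1 hT0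
    (tendsto_pow_div_pow_mul_exp_div_sq (norm_pos_iff.2 hE0) hr N M hs1 hsT)
  set x : ℕ → ℂ := fun n => L * s n + d with hxdef
  have hxs : Tendsto (fun n => x n / s n) atTop (𝓝 L) := by
    have h := (hsinv.const_mul d).const_add L
    rw [mul_zero, add_zero] at h
    refine h.congr fun n => ?_
    have := hsC n
    simp only [hxdef]
    field_simp
  have hxN : Tendsto (fun n => ‖x n‖) atTop atTop := by
    refine (hsN.atTop_mul_pos (norm_pos_iff.2 hL) hxs.norm).congr fun n => ?_
    rw [← norm_mul, mul_div_cancel₀ _ (hsC n)]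
  refine ⟨s, x, k, hs0, hk0, hsT, hkT, hxN, ?_, ?_, ?_⟩
  · have h : Tendsto (fun n => ((s n / k n : ℝ) : ℂ)) atTop (𝓝 0) := by
      rw [← ofReal_zero]
      exact (continuous_ofReal.tendsto _).comp hsk
    have h' := hxs.mul h
    rw [mul_zero] at h'
    refine h'.congr fun n => ?_
    have := hsC n
    push_cast
    field_simp
  · have h := (hxs.const_mul (2 * a₂)).add (hsinv.const_mul a₁)
    rw [mul_zero, add_zero, hLdef, mul_div_cancel₀ _ (mul_ne_zero two_ne_zero ha)] at h
    refine h.congr fun n => ?_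
    have := hsC n
    field_simp
  · have hQ := tendsto_ratio_div_pow γ lm β jp hL hxs hsN
    have hU : Tendsto (fun n => (((s n * k n) ^ α / T n : ℝ) : ℂ)) atTop (𝓝 1) := by
      rw [← ofReal_one]
      exact (continuous_ofReal.tendsto _).comp hskT
    have h := hU.mul (hQ.mul_const (E * exp c₀))
    have hlimit : 1 * (L ^ N / L ^ M * (E * exp c₀)) = exp A₀ := by
      rw [hE]
      have := exp_ne_zero c₀
      field_simp
    rw [hlimit] at h
    refine h.congr fun n => ?_
    have hpoly : a₂ * x n ^ 2 + a₁ * x n + a₀ = ((c₂.im * s n ^ 2 + τ * s n : ℝ) : ℂ) * I -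
        ((s n + -c₂.re * s n ^ 2 : ℝ) : ℂ) + c₀ := by
      have h1 : a₂ * L ^ 2 = c₂.re + c₂.im * I := by
        rw [re_add_im, hc₂, hLdef]
        push_cast
        field_simp
        norm_num
      have h2 : 2 * a₂ * L * d + a₁ * L = -1 + τ * I := by
        rw [hd, hLdef]
        field_simp
        ring
      push_cast
      simp only [hxdef, hc₀]
      linear_combination (s n : ℂ) ^ 2 * h1 + (s n : ℂ) * h2
    have hTne : (T n : ℂ) ≠ 0 := ofReal_ne_zero.2 (hT0 n).ne'
    have hTC : (T n : ℂ) = ‖E‖ * ((s n : ℂ) ^ M / (s n : ℂ) ^ N) *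
        exp ((s n + -c₂.re * s n ^ 2 : ℝ) : ℂ) := by
      simp only [hTdef]
      push_cast
      rfl
    have hval : (T n : ℂ) * expRat γ lm β jp a₂ a₁ a₀ (x n) =
        rootProd γ lm (x n) / rootProd β jp (x n) / ((s n : ℂ) ^ N / (s n : ℂ) ^ M) *
          (E * exp c₀) := by
      rw [expRat, hpoly, exp_add, exp_sub, hphase, hTC]
      conv_rhs => rw [← norm_mul_exp_arg_mul_I E]
      have := exp_ne_zero ((s n + -c₂.re * s n ^ 2 : ℝ) : ℂ)
      have := hsC n
      field_simp
    rw [← hval, ofReal_div, ← mul_assoc, div_mul_cancel₀ _ hTne]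

lemma exp_mem_piAlpha (ha : a₂ ≠ 0) (hα₁ : 0 < α) (hα₂ : α < 1) {b : ℂ} (hb : b ≠ 0)
    (hre : (b ^ 2 / a₂).re ≤ 0) (A₀ : ℂ) :
    (fun ζ => exp (A₀ + b * ζ)) ∈ PiAlpha α (expRat γ lm β jp a₂ a₁ a₀) := by
  obtain ⟨s, x, k, hs, hk, hsT, hkT, hx, hxk, hlin, hlim⟩ :=
    exists_exp_scaling (γ := γ) (lm := lm) (β := β) (jp := jp) (a₁ := a₁) (a₀ := a₀)
      ha hα₁ hα₂ hb hre A₀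
  have hkR : ∀ n, (0 : ℝ) < k n := fun n => Nat.cast_pos.2 (hk n)
  have hsk : Tendsto (fun n => s n * k n) atTop atTop :=
    hsT.atTop_mul_atTop₀ (tendsto_natCast_atTop_atTop.comp hkT)
  refine ⟨?_, ?_, 0, k, fun n => x n / k n, fun n => (s n * k n)⁻¹, hkT, hxk,
    fun n => inv_pos.2 (mul_pos (hs n) (hkR n)), hsk.inv_tendsto_atTop, ?_⟩
  · intro ζ _
    fun_prop
  · intro c hc
    have h1 := congrFun hc 0
    have h2 := congrFun hc b⁻¹
    simp only [mul_zero, add_zero, mul_inv_cancel₀ hb] at h1 h2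
    rw [exp_add, ← h1] at h2
    have h3 := congrArg norm ((mul_eq_left₀ (exp_ne_zero _)).1 h2)
    rw [norm_exp, one_re, norm_one, Real.exp_eq_one_iff] at h3
    exact one_ne_zero h3
  · refine sphLocUnifConv_of_tendsto_prod (by fun_prop) fun ζ => ?_
    have h1 := tendsto_expRat_div (γ := γ) (lm := lm) (β := β) (jp := jp) (a₀ := a₀) ha
      (hx.comp (tendsto_fst (f := atTop) (g := 𝓝 ζ))) (hlin.comp tendsto_fst) tendsto_snd
    have h2 := (hlim.comp (tendsto_fst (f := atTop) (g := 𝓝 ζ))).mul h1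
    rw [← exp_add] at h2
    refine h2.congr' ?_
    have hne := tendsto_fst (f := atTop) (g := 𝓝 ζ) |>.eventually
      (hlim.eventually_ne (exp_ne_zero _))
    filter_upwards [hne] with q hq
    have hq' := right_ne_zero_of_mul hq
    have hkq : (k q.1 : ℂ) ≠ 0 := Nat.cast_ne_zero.2 (hk _).ne'
    have hsq : (s q.1 : ℂ) ≠ 0 := ofReal_ne_zero.2 (hs _).ne'
    have harg : (k q.1 : ℂ) * (x q.1 / k q.1) + k q.1 * (((s q.1 * k q.1)⁻¹ : ℝ) : ℂ) * q.2 =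
        x q.1 + (s q.1 : ℂ)⁻¹ * q.2 := by
      push_cast
      field_simp
    have hpow : ((s q.1 * k q.1)⁻¹) ^ (-α) = (s q.1 * k q.1) ^ α := by
      have := (mul_pos (hs q.1) (hkR q.1)).le
      rw [Real.inv_rpow this, Real.rpow_neg this, inv_inv]
    rw [harg, hpow]
    simp only [Function.comp_apply]
    field_simp

end Construction

/-- (Theorem 1, case `k = 2`, `0 < α < 1`) For
`f = R·e^{a₂z² + a₁z + a₀}` with `a₂ ≠ 0` of argument `θa ∈ [0, 2π)`:
`Π_α(f) = ⋃ᵢ { ζ ↦ e^{P(γ i)}·A·(ζ + C)^(l i) : arg A = arg R̃_{γ i}(γ i), C ∈ ℂ } ∪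
{ ζ ↦ e^{A₀ + A₁ζ} : A₀ ∈ ℂ, A₁ = t·e^{iθ}, t > 0,
θ ∈ [π/4 + θa/2, 3π/4 + θa/2] ∪ [5π/4 + θa/2, 7π/4 + θa/2] }`. -/
theorem piAlpha_pos_quadratic
    (m p : ℕ) (γ : Fin m → ℂ) (β : Fin p → ℂ)
    (hγ : Function.Injective γ) (hβ : Function.Injective β) (hγβ : ∀ i j, γ i ≠ β j)
    (lm : Fin m → ℕ) (hlm : ∀ i, 1 ≤ lm i) (jp : Fin p → ℕ) (hjp : ∀ j, 1 ≤ jp j)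
    (R : ℂ → ℂ) (hR : R = fun z => (∏ i, (z - γ i) ^ lm i) / ∏ j, (z - β j) ^ jp j)
    (a₂ a₁ a₀ : ℂ) (ha₂ : a₂ ≠ 0)
    (θa : ℝ) (hθ₁ : 0 ≤ θa) (hθ₂ : θa < 2 * Real.pi)
    (hθ : a₂ = (‖a₂‖ : ℂ) * Complex.exp (θa * Complex.I))
    (f : ℂ → ℂ) (hf : f = fun z => R z * Complex.exp (a₂ * z ^ 2 + a₁ * z + a₀))
    (α : ℝ) (hα₁ : 0 < α) (hα₂ : α < 1) :
    PiAlpha α f =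
      { g | (∃ (i : Fin m) (A C : ℂ),
              (∃ t : ℝ, 0 < t ∧ A = (t : ℂ) *
                ((∏ j ∈ Finset.univ.erase i, (γ i - γ j) ^ lm j) /
                  ∏ j, (γ i - β j) ^ jp j)) ∧
              g = fun ζ => Complex.exp (a₂ * γ i ^ 2 + a₁ * γ i + a₀) * A *
                (ζ + C) ^ lm i) ∨
            (∃ A₀ A₁ : ℂ,
              (∃ t θ : ℝ, 0 < t ∧
                ((Real.pi / 4 + θa / 2 ≤ θ ∧ θ ≤ 3 * Real.pi / 4 + θa / 2) ∨
                  (5 * Real.pi / 4 + θa / 2 ≤ θ ∧ θ ≤ 7 * Real.pi / 4 + θa / 2)) ∧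
                A₁ = (t : ℂ) * Complex.exp ((θ : ℝ) * Complex.I)) ∧
              g = fun ζ => Complex.exp (A₀ + A₁ * ζ)) } := by
  have hfe : f = expRat γ lm β jp a₂ a₁ a₀ := by
    subst hf hR
    rfl
  have hcof : ∀ (i : Fin m) (t : ℝ), expRatCofactor γ lm β jp a₂ a₁ a₀ i (γ i) * t =
      exp (a₂ * γ i ^ 2 + a₁ * γ i + a₀) * (t *
        ((∏ j ∈ Finset.univ.erase i, (γ i - γ j) ^ lm j) / ∏ j, (γ i - β j) ^ jp j)) := by
    intro i t
    rw [expRatCofactor]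
    ring
  rw [hfe]
  ext g
  constructor
  · intro hg
    obtain ⟨ζ₀, c, x, σ, h⟩ := exists_rescaledLimit_of_mem_piAlpha hα₁ hg
    rcases h.eq_pow_or_eq_exp ha₂ hγ hγβ hlm with ⟨i, t, C, ht, hgη⟩ | ⟨b, hb, hre, hgη⟩
    · refine Or.inl ⟨i, _, C - ζ₀, ⟨t, ht, rfl⟩, funext fun ζ => ?_⟩
      have := hgη (ζ - ζ₀)
      rw [add_sub_cancel] at this
      rw [this, hcof, sub_add_eq_add_sub, add_sub_assoc]
    · refine Or.inr ⟨log (g ζ₀) - b * ζ₀, b,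
        (re_sq_div_nonpos_iff_exists_polar ha₂ hθ).1 ⟨hb, hre⟩, funext fun ζ => ?_⟩
      have h0 : g ζ₀ ≠ 0 := by simpa using h.g_zero_ne
      have := hgη (ζ - ζ₀)
      rw [add_sub_cancel, add_zero] at this
      rw [this, sub_add_eq_add_sub, add_sub_assoc, exp_add, exp_log h0, ← mul_sub]
  · rintro (⟨i, A, C, ⟨t, ht, rfl⟩, rfl⟩ | ⟨A₀, A₁, hA₁, rfl⟩)
    · rw [← hcof]
      exact pow_mem_piAlpha hγ hγβ hlm hα₁ hα₂ i ht C
    · obtain ⟨hb, hre⟩ := (re_sq_div_nonpos_iff_exists_polar ha₂ hθ).2 hA₁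
      exact exp_mem_piAlpha ha₂ hα₁ hα₂ hb hre A₀
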